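/- arXiv:2309.11237 — 2 statements merged into one kernel-verified Lean document; each statement's English description precedes it below -/
import Mathlib

section
/- For every integer k ≥ 2, twice the Gromov–Hausdorff distance between S^1 and S^k is at most kπ/(k+1). -/
open Real

noncomputable section

/-- Euclidean space ℝ^d. -/
abbrev Euc (d : ℕ) : Type := EuclideanSpace ℝ (Fin d)

/-- The unit sphere S^n = {x ∈ ℝ^{n+1} : ⟨x,x⟩ = 1}. -/
def usphere (n : ℕ) : Set (Euc (n+1)) := {x | @inner ℝ _ _ x x = (1:ℝ)}

/-- The geodesic distance d(x,y) = arccos⟨x,y⟩. -/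
def geoDist {d : ℕ} (x y : Euc d) : ℝ := Real.arccos (@inner ℝ _ _ x y)

/-- A correspondence between A ⊆ ℝ^{d₁} and B ⊆ ℝ^{d₂}: a relation R ⊆ A × B whose
coordinate projections to A and B are both surjective. -/
def IsCorrespondence {d₁ d₂ : ℕ} (A : Set (Euc d₁)) (B : Set (Euc d₂))
    (R : Set (Euc d₁ × Euc d₂)) : Prop :=
  (∀ z ∈ R, z.1 ∈ A ∧ z.2 ∈ B) ∧
  (∀ a ∈ A, ∃ b ∈ B, (a, b) ∈ R) ∧
  (∀ b ∈ B, ∃ a ∈ A, (a, b) ∈ R)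

/-- The distortion of a relation, with respect to the geodesic metrics:
dis(R) = sup |d(x,x') − d(y,y')| over (x,y), (x',y') ∈ R. -/
def distortion {d₁ d₂ : ℕ} (R : Set (Euc d₁ × Euc d₂)) : ℝ :=
  sSup {t | ∃ z ∈ R, ∃ w ∈ R, t = |geoDist z.1 w.1 - geoDist z.2 w.2|}

/-- Twice the Gromov–Hausdorff distance between S^n and S^k (geodesic metrics),
via the Kalton–Ostrovskii formula: the infimum of dis(R) over all correspondences R. -/
def twoGH (n k : ℕ) : ℝ :=
  sInf {t | ∃ R : Set (Euc (n+1) × Euc (k+1)),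
    IsCorrespondence (usphere n) (usphere k) R ∧ t = distortion R}

/-- The unit vector of the plane at angle `t`, scaled by `ε`. -/
def planeVec (ε t : ℝ) : Euc 2 := !₂[ε * cos t, ε * sin t]

lemma mem_usphere_iff_norm {n : ℕ} {x : Euc (n + 1)} : x ∈ usphere n ↔ ‖x‖ = 1 := by
  rw [usphere, Set.mem_ofPred_eq, real_inner_self_eq_norm_sq,
    pow_eq_one_iff_of_nonneg (norm_nonneg x) two_ne_zero]

lemma mem_usphere_iff_sum {n : ℕ} {x : Euc (n + 1)} : x ∈ usphere n ↔ ∑ i, x i ^ 2 = 1 := by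
  rw [usphere, Set.mem_ofPred_eq, real_inner_self_eq_norm_sq, EuclideanSpace.norm_sq_eq]
  simp only [norm_eq_abs, sq_abs]

lemma neg_mem_usphere {n : ℕ} {x : Euc (n + 1)} (hx : x ∈ usphere n) : -x ∈ usphere n := by
  simpa [mem_usphere_iff_norm] using hx

lemma geoDist_comm {d : ℕ} (x y : Euc d) : geoDist x y = geoDist y x := by
  simp [geoDist, real_inner_comm]

lemma geoDist_le_pi {d : ℕ} (x y : Euc d) : geoDist x y ≤ π := arccos_le_pi _

lemma geoDist_nonneg {d : ℕ} (x y : Euc d) : 0 ≤ geoDist x y := arccos_nonneg _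

lemma geoDist_neg_right {d : ℕ} (x y : Euc d) : geoDist x (-y) = π - geoDist x y := by
  simp [geoDist, arccos_neg]

lemma geoDist_triangle {n : ℕ} {x y z : Euc (n + 1)} (hx : x ∈ usphere n) (hy : y ∈ usphere n)
    (hz : z ∈ usphere n) : geoDist x z ≤ geoDist x y + geoDist y z := by
  rw [mem_usphere_iff_norm] at hx hy hz
  simpa [InnerProductGeometry.angle, geoDist, hx, hy, hz] using
    InnerProductGeometry.angle_le_angle_add_angle x y z

lemma geoDist_le_of_cos_le {d : ℕ} {x y : Euc d} {t : ℝ} (h0 : 0 ≤ t) (h1 : t ≤ π)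
    (h : cos t ≤ inner ℝ x y) : geoDist x y ≤ t := by
  simpa [geoDist, arccos_cos h0 h1] using arccos_le_arccos h

lemma le_geoDist_of_le_cos {d : ℕ} {x y : Euc d} {t : ℝ} (h0 : 0 ≤ t) (h1 : t ≤ π)
    (h : inner ℝ x y ≤ cos t) : t ≤ geoDist x y := by
  simpa [geoDist, arccos_cos h0 h1] using arccos_le_arccos h

lemma inner_planeVec (ε δ s t : ℝ) :
    inner ℝ (planeVec ε s) (planeVec δ t) = ε * δ * cos (s - t) := by
  simp [planeVec, PiLp.inner_apply, Fin.sum_univ_two, cos_sub]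
  ring

lemma neg_planeVec (ε t : ℝ) : -planeVec ε t = planeVec (-ε) t := by
  ext i; fin_cases i <;> simp [planeVec]

lemma planeVec_mem_usphere {ε : ℝ} (hε : ε ^ 2 = 1) (t : ℝ) : planeVec ε t ∈ usphere 1 := by
  rw [usphere, Set.mem_ofPred_eq, inner_planeVec, sub_self, cos_zero, mul_one, ← sq, hε]

lemma exists_planeVec_of_mem_usphere {s : Euc 2} (hs : s ∈ usphere 1) :
    ∃ t, s = planeVec 1 t := by
  have h : ‖(⟨s 0, s 1⟩ : ℂ)‖ = 1 := by
    rw [mem_usphere_iff_sum, Fin.sum_univ_two] at hs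
    rw [Complex.norm_def, Complex.normSq_mk, ← sq, ← sq, hs, sqrt_one]
  have h0 : (⟨s 0, s 1⟩ : ℂ) ≠ 0 := by
    intro h'; simp [h'] at h
  refine ⟨Complex.arg ⟨s 0, s 1⟩, ?_⟩
  ext i
  fin_cases i
  · simp [planeVec, Complex.cos_arg h0, h]
  · simp [planeVec, Complex.sin_arg, h]

/-- The correspondence between the circle and `S^k`: the cell of `S^k` on which `ε * x i` is the
largest absolute value of a coordinate is matched with a vertex of the regular `(2k+2)`-gon, and
the arc of the circle around that vertex is matched with the centre of the cell. -/
def cellCorrespondence (k : ℕ) : Set (Euc (1 + 1) × Euc (k + 1)) :=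
  {z | z.1 ∈ usphere 1 ∧ z.2 ∈ usphere k ∧ ∃ (i : Fin (k + 1)) (ε : ℝ), ε ^ 2 = 1 ∧
    ((z.1 = planeVec ε (i * (π / (k + 1))) ∧ ∀ j, |z.2 j| ≤ ε * z.2 i) ∨
     (geoDist z.1 (planeVec ε (i * (π / (k + 1)))) ≤ π / (k + 1) / 2 ∧
      z.2 = EuclideanSpace.single i ε))}

lemma neg_mem_cellCorrespondence {k : ℕ} {z : Euc (1 + 1) × Euc (k + 1)}
    (hz : z ∈ cellCorrespondence k) : -z ∈ cellCorrespondence k := by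
  obtain ⟨h1, h2, i, ε, hε, h⟩ := hz
  refine ⟨neg_mem_usphere h1, neg_mem_usphere h2, i, -ε, by simpa using hε, ?_⟩
  rcases h with ⟨h, h'⟩ | ⟨h, h'⟩
  · left
    refine ⟨by simp [h, neg_planeVec], fun j => by simpa using h' j⟩
  · right
    refine ⟨?_, by ext j; by_cases hj : j = i <;> simp [h', hj]⟩
    rw [← neg_planeVec, geoDist_neg_right, Prod.fst_neg, geoDist_comm, geoDist_neg_right,
      geoDist_comm]
    linarith

lemma exists_vertex_near {s : Euc 2} (hs : s ∈ usphere 1) (k : ℕ) :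
    ∃ (i : Fin (k + 1)) (ε : ℝ), ε ^ 2 = 1 ∧
      geoDist s (planeVec ε (i * (π / (k + 1)))) ≤ π / (k + 1) / 2 := by
  obtain ⟨t, rfl⟩ := exists_planeVec_of_mem_usphere hs
  have hn : (0 : ℝ) < k + 1 := by positivity
  set a := π / ((k : ℝ) + 1) with ha
  have ha0 : 0 < a := div_pos pi_pos hn
  have haπ : a ≤ π := div_le_self pi_pos.le (by linarith [(Nat.cast_nonneg k : (0 : ℝ) ≤ k)])
  set m : ℤ := round (t / a) with hm
  have hmod : m = (k + 1) * (m / (k + 1)) + m % (k + 1) := (Int.mul_ediv_add_emod _ _).symm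
  have hr0 : 0 ≤ m % ((k : ℤ) + 1) := Int.emod_nonneg _ (by omega)
  have hr1 : m % ((k : ℤ) + 1) < k + 1 := Int.emod_lt_of_pos _ (by omega)
  generalize m / ((k : ℤ) + 1) = q at hmod
  generalize m % ((k : ℤ) + 1) = r at hmod hr0 hr1
  lift r to ℕ using hr0
  refine ⟨⟨r, by omega⟩, (-1) ^ q, ?_, ?_⟩
  · rcases Int.even_or_odd q with h | h
    · simp [h.neg_one_zpow]
    · simp [h.neg_one_zpow]
  · apply geoDist_le_of_cos_le (by positivity) (by linarith)
    rw [inner_planeVec, one_mul]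
    have hma : (m : ℝ) * a = q * π + r * a := by
      rw [hmod, ha]; push_cast; field_simp
    have hcos : (-1) ^ q * cos (t - r * a) = cos (t - m * a) := by
      rw [hma, ← cos_sub_int_mul_pi]
      ring_nf
    change _ ≤ (-1) ^ q * cos (t - r * a)
    rw [hcos, ← cos_abs (t - m * a)]
    apply cos_le_cos_of_nonneg_of_le_pi (abs_nonneg _) (by linarith)
    have h := abs_sub_round (t / a)
    rw [← hm] at h
    calc |t - m * a| = |(t / a - m) * a| := by rw [sub_mul, div_mul_cancel₀ _ ha0.ne']
      _ = |t / a - m| * a := by rw [abs_mul, abs_of_pos ha0]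
      _ ≤ 1 / 2 * a := by gcongr
      _ = a / 2 := by ring

lemma exists_cell {k : ℕ} (x : Euc (k + 1)) :
    ∃ (i : Fin (k + 1)) (ε : ℝ), ε ^ 2 = 1 ∧ ∀ j, |x j| ≤ ε * x i := by
  obtain ⟨i, hi⟩ := Finite.exists_max fun j => |x j|
  rcases abs_cases (x i) with ⟨h, -⟩ | ⟨h, -⟩
  · exact ⟨i, 1, by norm_num, fun j => by simpa [h] using hi j⟩
  · exact ⟨i, -1, by norm_num, fun j => by simpa [h] using hi j⟩

lemma single_mem_usphere {k : ℕ} (i : Fin (k + 1)) {ε : ℝ} (hε : ε ^ 2 = 1) :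
    EuclideanSpace.single i ε ∈ usphere k := by
  rw [mem_usphere_iff_norm]
  rw [PiLp.norm_single, norm_eq_abs,
    ← pow_eq_one_iff_of_nonneg (abs_nonneg ε) two_ne_zero, sq_abs, hε]

lemma isCorrespondence_cellCorrespondence (k : ℕ) :
    IsCorrespondence (usphere 1) (usphere k) (cellCorrespondence k) := by
  refine ⟨fun z hz => ⟨hz.1, hz.2.1⟩, fun s hs => ?_, fun x hx => ?_⟩
  · obtain ⟨i, ε, hε, h⟩ := exists_vertex_near hs k
    exact ⟨_, single_mem_usphere i hε, hs, single_mem_usphere i hε, i, ε, hε, .inr ⟨h, rfl⟩⟩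
  · obtain ⟨i, ε, hε, h⟩ := exists_cell x
    have hv := planeVec_mem_usphere hε (i * (π / (k + 1)))
    exact ⟨_, hv, hv, hx, i, ε, hε, .inl ⟨rfl, h⟩⟩

lemma geoDist_vertices_le {k : ℕ} {i j : Fin (k + 1)} {ε δ : ℝ} (hε : ε ^ 2 = 1) (hδ : δ ^ 2 = 1)
    (h : i = j → δ = ε) :
    geoDist (planeVec ε (i * (π / (k + 1)))) (planeVec δ (j * (π / (k + 1)))) ≤
      k * (π / (k + 1)) := by
  have hn : (0 : ℝ) < k + 1 := by positivity
  set a := π / ((k : ℝ) + 1) with ha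
  have ha0 : 0 < a := div_pos pi_pos hn
  have hka : k * a + a = π := by rw [ha]; field_simp
  have hk0 : 0 ≤ k * a := by positivity
  apply geoDist_le_of_cos_le hk0 (by linarith)
  rw [inner_planeVec]
  by_cases hij : i = j
  · subst hij
    rw [h rfl, ← sq, hε, sub_self, cos_zero, mul_one]
    exact cos_le_one _
  · have hcos : |cos (i * a - j * a)| ≤ cos a := by
      rw [← cos_abs, ← sub_mul, abs_mul, abs_of_pos ha0]
      have h1 : (1 : ℝ) ≤ |(i : ℝ) - j| := by
        have : (1 : ℤ) ≤ |(i : ℤ) - j| := Int.one_le_abs (by omega)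
        exact_mod_cast this
      have h2 : |(i : ℝ) - j| ≤ k := by
        have : |(i : ℤ) - j| ≤ k := by rw [abs_le]; omega
        exact_mod_cast this
      have h3 := mul_le_mul_of_nonneg_right h1 ha0.le
      have h4 := mul_le_mul_of_nonneg_right h2 ha0.le
      rw [abs_le]
      constructor
      · rw [← cos_pi_sub]
        apply cos_le_cos_of_nonneg_of_le_pi <;> linarith
      · apply cos_le_cos_of_nonneg_of_le_pi <;> linarith
    have hεδ : |ε * δ| = 1 := by
      rw [← abs_one, ← sq_eq_sq_iff_abs_eq_abs, mul_pow, hε, hδ]; norm_num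
    have : k * a = π - a := by linarith
    rw [this, cos_pi_sub]
    have := neg_abs_le (ε * δ * cos (i * a - j * a))
    rw [abs_mul, hεδ, one_mul] at this
    linarith

lemma one_le_mul_sq_of_abs_le {k : ℕ} {x : Euc (k + 1)} (hx : x ∈ usphere k) {r : ℝ}
    (h : ∀ j, |x j| ≤ r) : 1 ≤ ((k : ℝ) + 1) * r ^ 2 := by
  rw [mem_usphere_iff_sum] at hx
  calc (1 : ℝ) = ∑ j, x j ^ 2 := hx.symm
    _ ≤ ∑ _j : Fin (k + 1), r ^ 2 := by
      refine Finset.sum_le_sum fun j _ => ?_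
      exact sq_le_sq' (by linarith [neg_abs_le (x j), h j]) ((le_abs_self _).trans (h j))
    _ = _ := by simp

lemma le_geoDist_of_mem_opposite_cells {k : ℕ} (hk : 2 ≤ k) {x y : Euc (k + 1)}
    (hx : x ∈ usphere k) (hy : y ∈ usphere k) {i : Fin (k + 1)} {ε : ℝ} (hε : ε ^ 2 = 1)
    (hxi : ∀ j, |x j| ≤ ε * x i) (hyi : ∀ j, |y j| ≤ -ε * y i) :
    π / (k + 1) ≤ geoDist x y := by
  have hn : (3 : ℝ) ≤ k + 1 := by
    have : (2 : ℝ) ≤ k := by exact_mod_cast hk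
    linarith
  have hp := one_le_mul_sq_of_abs_le hx hxi
  have hq := one_le_mul_sq_of_abs_le hy hyi
  have hp0 := (abs_nonneg _).trans (hxi i)
  have hq0 := (abs_nonneg _).trans (hyi i)
  have hd : (x i - y i) ^ 2 ≤ 2 - 2 * inner ℝ x y := by
    have h1 := norm_sub_sq_real x y
    rw [mem_usphere_iff_norm.1 hx, mem_usphere_iff_norm.1 hy] at h1
    have h2 := EuclideanSpace.norm_sq_eq (x - y)
    have h3 := Finset.single_le_sum (f := fun j => ‖(x - y) j‖ ^ 2)
      (fun j _ => sq_nonneg _) (Finset.mem_univ i)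
    simp only [PiLp.sub_apply, norm_eq_abs, sq_abs] at h2 h3
    linarith
  have hd' : (x i - y i) ^ 2 = (ε * x i + -ε * y i) ^ 2 := by
    linear_combination -(x i - y i) ^ 2 * hε
  rw [hd'] at hd
  generalize ε * x i = p at *
  generalize -ε * y i = q at *
  have hsq : 4 ≤ ((k : ℝ) + 1) * (p + q) ^ 2 := by
    have h1 : 1 ≤ ((k : ℝ) + 1) * (p * q) := by
      have : 1 ≤ (((k : ℝ) + 1) * (p * q)) ^ 2 := by nlinarith
      exact (one_le_sq_iff₀ (by positivity)).1 this
    nlinarith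
  have hn0 : (0 : ℝ) < k + 1 := by linarith
  apply le_geoDist_of_le_cos (by positivity) (div_le_self pi_pos.le (by linarith))
  refine le_trans ?_ (one_sub_sq_div_two_le_cos)
  have hpi : π ^ 2 ≤ 4 * (k + 1) := by nlinarith [pi_lt_d2, pi_pos]
  have h1 : (π / ((k : ℝ) + 1)) ^ 2 ≤ 4 / (k + 1) := by
    rw [div_pow, div_le_div_iff₀ (by positivity) hn0]
    nlinarith
  have h2 : 4 / ((k : ℝ) + 1) ≤ (p + q) ^ 2 := by
    rw [div_le_iff₀ hn0]; linarith
  linarith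

lemma pi_div_four_le_geoDist_single {k : ℕ} {x : Euc (k + 1)} (hx : x ∈ usphere k)
    {i j : Fin (k + 1)} (hij : i ≠ j) {ε δ : ℝ} (hε : ε ^ 2 = 1) (hδ : δ ^ 2 = 1)
    (hxi : ∀ j, |x j| ≤ ε * x i) : π / 4 ≤ geoDist x (EuclideanSpace.single j δ) := by
  apply le_geoDist_of_le_cos (by positivity) (by linarith [pi_pos])
  rw [cos_pi_div_four]
  have h1 : x i ^ 2 + x j ^ 2 ≤ 1 := by
    rw [mem_usphere_iff_sum] at hx
    rw [← hx, ← Finset.sum_pair (f := fun l => x l ^ 2) hij]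
    exact Finset.sum_le_sum_of_subset_of_nonneg (Finset.subset_univ _) fun _ _ _ => sq_nonneg _
  have h2 : x j ^ 2 ≤ x i ^ 2 := by
    have h := pow_le_pow_left₀ (abs_nonneg _) (hxi j) 2
    rwa [sq_abs, mul_pow, hε, one_mul] at h
  have h3 : (δ * x j) ^ 2 ≤ (√2 / 2) ^ 2 := by
    rw [mul_pow, hδ, div_pow, sq_sqrt (by norm_num)]; linarith
  have h4 := abs_le_of_sq_le_sq' h3 (by positivity)
  simpa [EuclideanSpace.inner_single_right, mul_comm] using h4.2

lemma eq_neg_of_sq_eq_one {ε δ : ℝ} (hε : ε ^ 2 = 1) (hδ : δ ^ 2 = 1) (h : δ ≠ ε) : δ = -ε :=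
  (sq_eq_sq_iff_eq_or_eq_neg.1 (hδ.trans hε.symm)).resolve_left h

lemma pi_div_two_le_geoDist {d : ℕ} {x y : Euc d} (h : inner ℝ x y ≤ 0) :
    π / 2 ≤ geoDist x y :=
  le_geoDist_of_le_cos (by positivity) (by linarith [pi_pos]) (by simpa using h)

lemma geoDist_le_of_mem_cell_of_mem_arc {k : ℕ} (hk : 2 ≤ k) {x : Euc (k + 1)} {s : Euc 2}
    (hx : x ∈ usphere k) (hs : s ∈ usphere 1) {i j : Fin (k + 1)} {ε δ : ℝ}
    (hε : ε ^ 2 = 1) (hδ : δ ^ 2 = 1) (hxi : ∀ j, |x j| ≤ ε * x i)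
    (hsj : geoDist s (planeVec δ (j * (π / (k + 1)))) ≤ π / (k + 1) / 2) :
    geoDist (planeVec ε (i * (π / (k + 1)))) s ≤
      geoDist x (EuclideanSpace.single j δ) + k * (π / (k + 1)) := by
  have hn : (2 : ℝ) ≤ k := by exact_mod_cast hk
  have hka : k * (π / ((k : ℝ) + 1)) + π / (k + 1) = π := by field_simp
  have ha0 : 0 < π / ((k : ℝ) + 1) := by positivity
  have hle := mul_le_mul_of_nonneg_right hn ha0.le
  by_cases h : i = j → δ = ε
  · have h1 := geoDist_triangle (planeVec_mem_usphere hε (i * (π / (k + 1))))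
      (planeVec_mem_usphere hδ (j * (π / (k + 1)))) hs
    have h2 := geoDist_vertices_le hε hδ h
    rw [geoDist_comm] at hsj
    by_cases hij : i = j
    · obtain rfl := h hij
      subst hij
      linarith [geoDist_nonneg x (EuclideanSpace.single i δ)]
    · linarith [pi_div_four_le_geoDist_single hx hij hε hδ hxi]
  · push Not at h
    obtain ⟨rfl, h⟩ := h
    obtain rfl := eq_neg_of_sq_eq_one hε hδ h
    have h1 : inner ℝ x (EuclideanSpace.single i (-ε)) ≤ 0 := by
      have := (abs_nonneg _).trans (hxi i)
      simpa [EuclideanSpace.inner_single_right, mul_comm] using this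
    linarith [pi_div_two_le_geoDist h1, geoDist_le_pi (planeVec ε (i * (π / (k + 1)))) s]

lemma geoDist_le_of_mem_arcs {k : ℕ} (hk : 2 ≤ k) {s t : Euc 2}
    (hs : s ∈ usphere 1) (ht : t ∈ usphere 1) {i j : Fin (k + 1)} {ε δ : ℝ}
    (hε : ε ^ 2 = 1) (hδ : δ ^ 2 = 1)
    (hsi : geoDist s (planeVec ε (i * (π / (k + 1)))) ≤ π / (k + 1) / 2)
    (htj : geoDist t (planeVec δ (j * (π / (k + 1)))) ≤ π / (k + 1) / 2) :
    geoDist s t ≤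
      geoDist (EuclideanSpace.single i ε) (EuclideanSpace.single j δ) + k * (π / (k + 1)) := by
  have hn : (2 : ℝ) ≤ k := by exact_mod_cast hk
  have hka : k * (π / ((k : ℝ) + 1)) + π / (k + 1) = π := by field_simp
  have ha0 : 0 < π / ((k : ℝ) + 1) := by positivity
  have hle := mul_le_mul_of_nonneg_right hn ha0.le
  by_cases h : i = j ∧ δ = ε
  · obtain ⟨rfl, rfl⟩ := h
    have h1 := geoDist_triangle hs (planeVec_mem_usphere hδ (i * (π / (k + 1)))) ht
    rw [geoDist_comm t] at htj
    linarith [geoDist_nonneg (EuclideanSpace.single i δ) (EuclideanSpace.single i δ)]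
  · have h1 : inner ℝ (EuclideanSpace.single i ε) (EuclideanSpace.single j δ) ≤ 0 := by
      by_cases hij : i = j
      · obtain rfl := eq_neg_of_sq_eq_one hε hδ fun h' => h ⟨hij, h'⟩
        simpa [hij, EuclideanSpace.inner_single_right] using mul_self_nonneg ε
      · simp [EuclideanSpace.inner_single_right, Ne.symm hij]
    linarith [pi_div_two_le_geoDist h1, geoDist_le_pi s t]

lemma geoDist_le_of_mem_cellCorrespondence {k : ℕ} (hk : 2 ≤ k)
    {z w : Euc (1 + 1) × Euc (k + 1)} (hz : z ∈ cellCorrespondence k)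
    (hw : w ∈ cellCorrespondence k) :
    geoDist z.1 w.1 ≤ geoDist z.2 w.2 + k * (π / (k + 1)) := by
  obtain ⟨s, x⟩ := z
  obtain ⟨t, y⟩ := w
  obtain ⟨hs, hx, i, ε, hε, hz⟩ := hz
  obtain ⟨ht, hy, j, δ, hδ, hw⟩ := hw
  dsimp only at *
  rcases hz with ⟨rfl, hxi⟩ | ⟨hsi, rfl⟩ <;> rcases hw with ⟨rfl, hyj⟩ | ⟨htj, rfl⟩
  · by_cases h : i = j → δ = ε
    · linarith [geoDist_vertices_le hε hδ h, geoDist_nonneg x y]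
    · push Not at h
      obtain ⟨rfl, h⟩ := h
      obtain rfl := eq_neg_of_sq_eq_one hε hδ h
      have hka : k * (π / ((k : ℝ) + 1)) + π / (k + 1) = π := by field_simp
      linarith [le_geoDist_of_mem_opposite_cells hk hx hy hε hxi hyj, geoDist_le_pi
        (planeVec ε (i * (π / (k + 1)))) (planeVec (-ε) (i * (π / (k + 1))))]
  · exact geoDist_le_of_mem_cell_of_mem_arc hk hx ht hε hδ hxi htj
  · rw [geoDist_comm s, geoDist_comm _ y]
    exact geoDist_le_of_mem_cell_of_mem_arc hk hy hs hδ hε hyj hsi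
  · exact geoDist_le_of_mem_arcs hk hs ht hε hδ hsi htj

lemma distortion_nonneg {d₁ d₂ : ℕ} (R : Set (Euc d₁ × Euc d₂)) : 0 ≤ distortion R := by
  apply sSup_nonneg
  rintro _ ⟨z, _, w, _, rfl⟩
  exact abs_nonneg _

lemma twoGH_le_distortion {n k : ℕ} {R : Set (Euc (n + 1) × Euc (k + 1))}
    (hR : IsCorrespondence (usphere n) (usphere k) R) : twoGH n k ≤ distortion R := by
  refine csInf_le ⟨0, ?_⟩ ⟨R, hR, rfl⟩
  rintro _ ⟨R', _, rfl⟩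
  exact distortion_nonneg R'

lemma distortion_cellCorrespondence_le {k : ℕ} (hk : 2 ≤ k) :
    distortion (cellCorrespondence k) ≤ k * (π / (k + 1)) := by
  refine Real.sSup_le ?_ (by positivity)
  rintro _ ⟨z, hz, w, hw, rfl⟩
  have h1 := geoDist_le_of_mem_cellCorrespondence hk hz hw
  have h2 := geoDist_le_of_mem_cellCorrespondence hk hz (neg_mem_cellCorrespondence hw)
  rw [Prod.fst_neg, Prod.snd_neg, geoDist_neg_right, geoDist_neg_right] at h2
  rw [abs_le]
  constructor <;> linarith

/-- For every integer k ≥ 2, twice the Gromov–Hausdorff distance between S^1 and S^k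
is at most kπ/(k+1). -/
theorem two_dGH_S1_le (k : ℕ) (hk : 2 ≤ k) :
    twoGH 1 k ≤ (k : ℝ) * π / ((k : ℝ) + 1) := by
  rw [mul_div_assoc]
  exact (twoGH_le_distortion (isCorrespondence_cellCorrespondence k)).trans
    (distortion_cellCorrespondence_le hk)
end
end

section
/- Let k ≥ 3 be odd and 1 ≤ m ≤ 2k+2. For all x ≠ y in 𝒢_m, the circle distance between the angles f_m(x) and f_m(y) is strictly less than the geodesic distance d_{S^k}(x,y) = arccos⟨x,y⟩; that is, each f_m is strictly distance-decreasing. -/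
open Real

noncomputable section

/-- The circle distance between two angles θ, φ ∈ ℝ: the representative of
|θ − φ| modulo 2π lying in [0, π] (the geodesic distance in S¹ between
(cos θ, sin θ) and (cos φ, sin φ)). -/
def circleDist (θ φ : ℝ) : ℝ := Real.arccos (Real.cos (θ - φ))

/-- The coordinate index (0-based) of the cell 𝒢_m: the 1-based index m reduced
modulo k+1 to {1,…,k+1}, shifted to 0-based. -/
def gIdx (k m : ℕ) : Fin (k+1) := ⟨(m - 1) % (k + 1), Nat.mod_lt _ (Nat.succ_pos k)⟩

/-- The sign of the cell 𝒢_m: writing m − 1 = q(k+1) + r, the sign is (−1)^{r+q}.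
For 1 ≤ m ≤ k+1 this is (−1)^{m+1}, and 𝒢_{m+k+1} = −𝒢_m. -/
def gSign (k m : ℕ) : ℝ := (-1) ^ ((m - 1) % (k + 1) + (m - 1) / (k + 1))

/-- The cell 𝒢_m = (−1)^{m+1} G_{m mod (k+1)} ⊆ S^k, where G_i is the Voronoi cell
of the standard basis vector e_i with respect to {±e₁,…,±e_{k+1}}:
x ∈ 𝒢_m iff x ∈ S^k and the signed coordinate gSign·x_{gIdx} dominates all |x_j|. -/
def Gcal (k m : ℕ) : Set (Euc (k+1)) :=
  {x | x ∈ usphere k ∧ ∀ j, |x j| ≤ gSign k m * x (gIdx k m)}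

/-- The function f_m : 𝒢_m → ℝ (an angle parametrizing S¹),
f_m(x) = (m−1)π/(k+1) + (π/(2k(k+1)))·(x_1 + ⋯ + x_{m−1} − x_{m+1} − ⋯ − x_{k+1})/x_m,
coordinate subscripts taken modulo k+1 (as angles, i.e. modulo 2π, for m > k+1). -/
def fFun (k m : ℕ) (x : Euc (k+1)) : ℝ :=
  ((m : ℝ) - 1) * π / ((k : ℝ) + 1) + π / (2 * (k : ℝ) * ((k : ℝ) + 1)) *
    ((∑ j : Fin (k+1),
        (if (j : ℕ) < (m - 1) % (k + 1) then (1:ℝ)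
         else if (j : ℕ) = (m - 1) % (k + 1) then 0 else -1) * x j) / x (gIdx k m))

theorem euc_inner_eq_sum {d : ℕ} (x y : Euc d) : @inner ℝ _ _ x y = ∑ j, x j * y j := by
  rw [PiLp.inner_apply]
  exact Finset.sum_congr rfl fun j _ => by simp [mul_comm]

/-- Nonnegativity of the Gram determinant of two unit vectors and a basis vector. -/
theorem gram_basis_nonneg {d : ℕ} (x y : Euc d) (i : Fin d)
    (hx : ∑ j, x j * x j = 1) (hy : ∑ j, y j * y j = 1) :
    x i ^ 2 + y i ^ 2 - 2 * (∑ j, x j * y j) * (x i * y i) ≤ 1 - (∑ j, x j * y j) ^ 2 := by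
  have h := Finset.sum_mul_sq_le_sq_mul_sq (Finset.univ.erase i) (fun j => x j) (fun j => y j)
  have e (z w : Euc d) : ∑ j ∈ Finset.univ.erase i, z j * w j = ∑ j, z j * w j - z i * w i := by
    rw [← Finset.add_sum_erase _ _ (Finset.mem_univ i)]; ring
  simp only [pow_two (x _), pow_two (y _), e, hx, hy] at h
  nlinarith [h]

/-- Cauchy–Schwarz for a linear functional of the gnomonic coordinates of two unit vectors. -/
theorem sq_sum_div_sub_div_le {d : ℕ} (x y : Euc d) (i : Fin d) (ε : Fin d → ℝ)
    (hx : ∑ j, x j * x j = 1) (hy : ∑ j, y j * y j = 1) (hxi : x i ≠ 0) (hyi : y i ≠ 0) :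
    ((∑ j, ε j * x j) / x i - (∑ j, ε j * y j) / y i) ^ 2 * (x i * y i) ^ 2
      ≤ (∑ j, ε j ^ 2) * (1 - (∑ j, x j * y j) ^ 2) := by
  have h := Finset.sum_mul_sq_le_sq_mul_sq Finset.univ ε (fun j => y i * x j - x i * y j)
  have e1 : ∑ j, ε j * (y i * x j - x i * y j)
      = ((∑ j, ε j * x j) / x i - (∑ j, ε j * y j) / y i) * (x i * y i) := by
    have : ∑ j, ε j * (y i * x j - x i * y j)
        = y i * (∑ j, ε j * x j) - x i * ∑ j, ε j * y j := by
      rw [Finset.mul_sum, Finset.mul_sum, ← Finset.sum_sub_distrib]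
      exact Finset.sum_congr rfl fun j _ => by ring
    rw [this]; field_simp
  have e2 : ∑ j, (y i * x j - x i * y j) ^ 2
      = x i ^ 2 + y i ^ 2 - 2 * (∑ j, x j * y j) * (x i * y i) := by
    have : ∑ j, (y i * x j - x i * y j) ^ 2 = y i ^ 2 * (∑ j, x j * x j)
        + x i ^ 2 * (∑ j, y j * y j) - 2 * (x i * y i) * ∑ j, x j * y j := by
      rw [Finset.mul_sum, Finset.mul_sum, Finset.mul_sum, ← Finset.sum_add_distrib,
        ← Finset.sum_sub_distrib]
      exact Finset.sum_congr rfl fun j _ => by ring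
    rw [this, hx, hy]; ring
  rw [← mul_pow, ← e1]
  refine h.trans (mul_le_mul_of_nonneg_left ?_ (Finset.sum_nonneg fun j _ => sq_nonneg _))
  rw [e2]
  exact gram_basis_nonneg x y i hx hy

theorem norm_eq_one_of_mem_usphere {n : ℕ} {x : Euc (n+1)} (hx : x ∈ usphere n) : ‖x‖ = 1 := by
  have h : @inner ℝ _ _ x x = (1 : ℝ) := hx
  rw [real_inner_self_eq_norm_sq] at h
  nlinarith [norm_nonneg x]

/-- The dominating coordinate of a unit vector in `ℝ^(k+1)` has square at least `1/(k+1)`. -/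
theorem one_le_mul_sq_of_mem_Gcal {k m : ℕ} {x : Euc (k+1)} (hx : x ∈ Gcal k m) :
    1 ≤ ((k : ℝ) + 1) * x (gIdx k m) ^ 2 := by
  have hs : gSign k m ^ 2 = 1 := by
    rw [gSign, ← pow_mul, mul_comm, pow_mul]; norm_num
  have h1 : ∑ j, x j * x j = 1 := by rw [← euc_inner_eq_sum]; exact hx.1
  have h2 : ∑ j, x j * x j ≤ ∑ _j : Fin (k+1), x (gIdx k m) ^ 2 := by
    refine Finset.sum_le_sum fun j _ => ?_
    have h := pow_le_pow_left₀ (abs_nonneg _) (hx.2 j) 2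
    rw [sq_abs, mul_pow, hs, one_mul] at h
    linarith [pow_two (x j)]
  rw [h1] at h2
  simpa using h2

theorem circleDist_eq_abs (θ φ : ℝ) (h : |θ - φ| ≤ π) : circleDist θ φ = |θ - φ| := by
  rw [circleDist, ← Real.cos_abs, Real.arccos_cos (abs_nonneg _) h]

theorem one_sub_sq_le_arccos_sq {t : ℝ} (h1 : -1 ≤ t) (h2 : t ≤ 1) :
    1 - t ^ 2 ≤ Real.arccos t ^ 2 := by
  have h := Real.sin_le (Real.arccos_nonneg t)
  rw [Real.sin_arccos] at h
  have h3 := pow_le_pow_left₀ (Real.sqrt_nonneg _) h 2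
  rwa [Real.sq_sqrt (by nlinarith)] at h3

/-- The coefficient of the `j`-th coordinate in `fFun`, for the cell with index `i`. -/
def signCoeff {d : ℕ} (i j : Fin d) : ℝ :=
  if (j : ℕ) < i then 1 else if (j : ℕ) = i then 0 else -1

theorem sum_signCoeff_sq (k : ℕ) (i : Fin (k+1)) : ∑ j, signCoeff i j ^ 2 = k := by
  have : ∀ j, signCoeff i j ^ 2 = 1 - if j = i then 1 else 0 := by
    intro j
    simp only [signCoeff, Fin.ext_iff]
    split_ifs <;> first | omega | norm_num
  rw [Finset.sum_congr rfl fun j _ => this j, Finset.sum_sub_distrib]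
  simp

/-- Let k ≥ 3 be odd and 1 ≤ m ≤ 2k+2. Each f_m is strictly distance-decreasing:
for x ≠ y in 𝒢_m, the circle distance between f_m(x) and f_m(y) is strictly less
than the geodesic distance arccos⟨x,y⟩. -/
theorem fFun_dist_dec (k : ℕ) (hk : 3 ≤ k) (hodd : Odd k)
    (m : ℕ) (hm1 : 1 ≤ m) (hm2 : m ≤ 2*k+2)
    (x y : Euc (k+1)) (hx : x ∈ Gcal k m) (hy : y ∈ Gcal k m) (hxy : x ≠ y) :
    circleDist (fFun k m x) (fFun k m y) < geoDist x y := by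
  have hX : ∑ j, x j * x j = 1 := by rw [← euc_inner_eq_sum]; exact hx.1
  have hY : ∑ j, y j * y j = 1 := by rw [← euc_inner_eq_sum]; exact hy.1
  have hxn := norm_eq_one_of_mem_usphere hx.1
  have hyn := norm_eq_one_of_mem_usphere hy.1
  have hlt : @inner ℝ _ _ x y < (1 : ℝ) := (inner_lt_one_iff_real_of_norm_eq_one hxn hyn).2 hxy
  have hge : (-1 : ℝ) ≤ @inner ℝ _ _ x y := by
    have h := abs_real_inner_le_norm x y
    rw [hxn, hyn, one_mul] at h
    exact (abs_le.1 h).1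
  have hpos : 0 < geoDist x y := Real.arccos_pos.2 hlt
  have hα := one_le_mul_sq_of_mem_Gcal hx
  have hβ := one_le_mul_sq_of_mem_Gcal hy
  have hα0 : x (gIdx k m) ≠ 0 := by
    intro h; rw [h] at hα; norm_num at hα
  have hβ0 : y (gIdx k m) ≠ 0 := by
    intro h; rw [h] at hβ; norm_num at hβ
  have hCS := sq_sum_div_sub_div_le x y (gIdx k m) (signCoeff (gIdx k m)) hX hY hα0 hβ0
  rw [sum_signCoeff_sq, ← euc_inner_eq_sum] at hCS
  have hδ : fFun k m x - fFun k m y = π / (2 * (k : ℝ) * ((k : ℝ) + 1)) *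
      ((∑ j, signCoeff (gIdx k m) j * x j) / x (gIdx k m)
        - (∑ j, signCoeff (gIdx k m) j * y j) / y (gIdx k m)) := by
    rw [mul_sub, fFun, fFun, add_sub_add_left_eq_sub]; rfl
  set D := (∑ j, signCoeff (gIdx k m) j * x j) / x (gIdx k m)
        - (∑ j, signCoeff (gIdx k m) j * y j) / y (gIdx k m)
  have hk3 : (3 : ℝ) ≤ k := by exact_mod_cast hk
  have hsin : 1 - (@inner ℝ _ _ x y : ℝ) ^ 2 ≤ geoDist x y ^ 2 :=
    one_sub_sq_le_arccos_sq hge hlt.le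
  have hD : D ^ 2 ≤ ((k : ℝ) + 1) ^ 2 * (k * geoDist x y ^ 2) := by
    have h1 : 1 ≤ ((k : ℝ) + 1) ^ 2 * (x (gIdx k m) * y (gIdx k m)) ^ 2 := by
      nlinarith [one_le_mul_of_one_le_of_one_le hα hβ]
    calc D ^ 2 ≤ D ^ 2 * (((k : ℝ) + 1) ^ 2 * (x (gIdx k m) * y (gIdx k m)) ^ 2) :=
          le_mul_of_one_le_right (sq_nonneg _) h1
      _ = ((k : ℝ) + 1) ^ 2 * (D ^ 2 * (x (gIdx k m) * y (gIdx k m)) ^ 2) := by ring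
      _ ≤ _ := mul_le_mul_of_nonneg_left (hCS.trans (by gcongr)) (sq_nonneg _)
  have hsq : (fFun k m x - fFun k m y) ^ 2 < geoDist x y ^ 2 := by
    have hπ : π ^ 2 < 4 * k := by nlinarith [Real.pi_lt_d2, Real.pi_pos]
    calc (fFun k m x - fFun k m y) ^ 2
        = (π / (2 * (k : ℝ) * ((k : ℝ) + 1))) ^ 2 * D ^ 2 := by rw [hδ]; ring
      _ ≤ (π / (2 * (k : ℝ) * ((k : ℝ) + 1))) ^ 2 *
          (((k : ℝ) + 1) ^ 2 * (k * geoDist x y ^ 2)) := by gcongr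
      _ = π ^ 2 / (4 * k) * geoDist x y ^ 2 := by field_simp; ring
      _ < geoDist x y ^ 2 :=
          mul_lt_of_lt_one_left (by positivity) ((div_lt_one (by positivity)).2 hπ)
  have habs := abs_lt_of_sq_lt_sq hsq hpos.le
  rwa [circleDist_eq_abs _ _ (habs.le.trans (Real.arccos_le_pi _))]
end
end
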